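/- In the standard setup, suppose a = b_i⁺ and c = b_j⁻ are distinct vertices for some i < j, with ac ∈ E(G). If x ∈ {b_{i+1}⁻, …, b_{j−1}⁻}, then xa⁻ ∉ E(G) and xc⁺ ∉ E(G). -/

import Mathlib

open scoped Classical

namespace Paper

noncomputable section

variable {V : Type*}

/-- degree as cardinality of neighbor set -/
def deg (G : SimpleGraph V) (x : V) : ℕ := (G.neighborSet x).ncard

/-- G is 1-tough -/
def OneTough (G : SimpleGraph V) : Prop :=
  ∀ S : Set V, S.Nonempty → Nat.card ((G.induce Sᶜ).ConnectedComponent) ≤ S.ncard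

def IsIndepTriple (G : SimpleGraph V) (s : Finset V) : Prop :=
  s.card = 3 ∧ ∀ x ∈ s, ∀ y ∈ s, x ≠ y → ¬ G.Adj x y

def sigma3 [Fintype V] (G : SimpleGraph V) : ℕ :=
  if ∃ s : Finset V, IsIndepTriple G s then
    sInf {k | ∃ s : Finset V, IsIndepTriple G s ∧ ∑ x ∈ s, deg G x = k}
  else 3 * (Fintype.card V - 1)

def NC2 [Fintype V] (G : SimpleGraph V) : ℕ :=
  if G = ⊤ then Fintype.card V - 1
  else sInf {k | ∃ x y : V, G.dist x y = 2 ∧ (G.neighborSet x ∪ G.neighborSet y).ncard = k}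

def circumference (G : SimpleGraph V) : ℕ :=
  sSup {k | ∃ (a : V) (w : G.Walk a a), w.IsCycle ∧ w.length = k}

def IsLongestCycle (G : SimpleGraph V) {a : V} (c : G.Walk a a) : Prop :=
  c.IsCycle ∧ ∀ (b : V) (w : G.Walk b b), w.IsCycle → w.length ≤ c.length

/-- successor of a vertex along the oriented cycle `c` (identity off the cycle) -/
def cSucc [DecidableEq V] {G : SimpleGraph V} {a : V} (c : G.Walk a a) (x : V) : V :=
  if h : x ∈ c.support.tail then c.support.tail.next x h else x

/-- predecessor of a vertex along the oriented cycle `c` (identity off the cycle) -/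
def cPred [DecidableEq V] {G : SimpleGraph V} {a : V} (c : G.Walk a a) (x : V) : V :=
  if h : x ∈ c.support.tail then c.support.tail.prev x h else x

/-- vertices strictly between `x` and `y` going forward along `c` -/
def arc [DecidableEq V] {G : SimpleGraph V} {a : V} (c : G.Walk a a) (x y : V) : Set V :=
  {z | ∃ i k : ℕ, 0 < i ∧ i < k ∧ k < c.length ∧ (cSucc c)^[k] x = y ∧ z = (cSucc c)^[i] x}

/-- length of the interval of the cycle `c` starting at `b` determined by `B` -/
def intervalLen [DecidableEq V] {G : SimpleGraph V} {a : V} (c : G.Walk a a)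
    (B : Set V) (b : V) : ℕ :=
  sInf {k | 0 < k ∧ (cSucc c)^[k] b ∈ B}

/-- inner vertices of the interval of the cycle `c` starting at `b` determined by `B` -/
def innerVerts [DecidableEq V] {G : SimpleGraph V} {a : V} (c : G.Walk a a)
    (B : Set V) (b : V) : Set V :=
  {x | ∃ i, 0 < i ∧ i < intervalLen c B b ∧ x = (cSucc c)^[i] b}

/-- the union of the neighborhoods of the vertices in `S` -/
def nbhdSet (G : SimpleGraph V) (S : Set V) : Set V := {z | ∃ y ∈ S, G.Adj y z}

/-- a set of vertices is independent -/
def IsIndepSet (G : SimpleGraph V) (S : Set V) : Prop :=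
  ∀ x ∈ S, ∀ y ∈ S, ¬ G.Adj x y

/-- A path whose two ends are adjacent to a vertex off it closes up to a cycle. -/
theorem exists_isCycle_of_isPath {G : SimpleGraph V} {x y z : V} {w : G.Walk x y}
    (hw : w.support.Nodup) (hxy : x ≠ y) (hz : z ∉ w.support) (hx : G.Adj z x)
    (hy : G.Adj y z) :
    ∃ (b : V) (d : G.Walk b b), d.IsCycle ∧ d.length = w.support.length + 1 := by
  refine ⟨z, .cons hx (w.concat hy), ?_, by simp⟩
  rw [SimpleGraph.Walk.cons_isCycle_iff]
  refine ⟨(SimpleGraph.Walk.concat_isPath_iff hy).2 ⟨.mk' hw, hz⟩, ?_⟩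
  rw [SimpleGraph.Walk.edges_concat]
  simp only [List.concat_eq_append, List.mem_append, List.mem_singleton, not_or]
  refine ⟨fun h => hz (w.fst_mem_support_of_mem_edges h), fun h => ?_⟩
  simp only [Sym2.eq_iff] at h
  rcases h with ⟨rfl, -⟩ | ⟨-, rfl⟩
  · exact hy.ne rfl
  · exact hxy rfl

/-- Two disjoint paths, linked at one pair of ends by `p` and at the other pair by `q`,
form a cycle. -/
theorem exists_isCycle_of_linked {G : SimpleGraph V} {s e e' t p q : V} (w : G.Walk s e)
    (w' : G.Walk e' t) (hnd : (p :: q :: (w.support ++ w'.support)).Nodup)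
    (hps : G.Adj p s) (hpt : G.Adj p t) (hqe : G.Adj q e) (hqe' : G.Adj q e') :
    ∃ (b : V) (d : G.Walk b b), d.IsCycle ∧
      d.length = w.support.length + w'.support.length + 2 := by
  have hsupp : (w.append (.cons hqe.symm (.cons hqe' w'))).support =
      w.support ++ q :: w'.support := by
    simp [SimpleGraph.Walk.support_append]
  have hperm : (p :: (w.support ++ q :: w'.support)).Nodup :=
    ((List.perm_middle.cons p).nodup_iff).2 hnd
  obtain ⟨hp, hnd'⟩ := List.nodup_cons.1 hperm
  have hst : s ≠ t := by
    rintro rfl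
    exact (List.nodup_append.1 hnd').2.2 _ w.start_mem_support _
      (List.mem_cons_of_mem _ w'.end_mem_support) rfl
  obtain ⟨b, d, hd, hl⟩ := exists_isCycle_of_isPath (hsupp ▸ hnd') hst (hsupp ▸ hp) hps hpt.symm
  refine ⟨b, d, hd, ?_⟩
  rw [hl, hsupp, List.length_append, List.length_cons]
  omega

/-- If `s` and `t` are common neighbours of `u` and `v`, and `e`, `e'` are each adjacent to one of
them, then an `s`-`e` path and a disjoint `e'`-`t` path extend to a cycle through `u` and `v`. -/
theorem exists_isCycle_of_two_paths {G : SimpleGraph V} {s e e' t u v : V} (w : G.Walk s e)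
    (w' : G.Walk e' t) (hnd : (u :: v :: (w.support ++ w'.support)).Nodup)
    (hus : G.Adj u s) (hut : G.Adj u t) (hvs : G.Adj v s) (hvt : G.Adj v t)
    (he : G.Adj u e ∨ G.Adj v e) (he' : G.Adj u e' ∨ G.Adj v e') :
    ∃ (b : V) (d : G.Walk b b), d.IsCycle ∧
      d.length = w.support.length + w'.support.length + 2 := by
  have hnd₁ : (v :: u :: (w.support ++ w'.support)).Nodup :=
    ((List.Perm.swap _ _ _).nodup_iff).1 hnd
  have hrev : (w.support ++ w'.reverse.support).Perm (w.support ++ w'.support) := by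
    rw [SimpleGraph.Walk.support_reverse]
    exact (List.reverse_perm _).append_left _
  have hlen : w'.reverse.support.length = w'.support.length := by simp
  rcases he with he | he <;> rcases he' with he' | he'
  · exact exists_isCycle_of_linked w w' hnd₁ hvs hvt he he'
  · rw [← hlen]
    exact exists_isCycle_of_linked w w'.reverse (((hrev.cons u).cons v).nodup_iff.2 hnd₁)
      hvs he' he hut
  · rw [← hlen]
    exact exists_isCycle_of_linked w w'.reverse (((hrev.cons v).cons u).nodup_iff.2 hnd)
      hus he' he hvt
  · exact exists_isCycle_of_linked w w' hnd hus hut he he'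

/-- The segment from `f s` to `f t` of a walk given by a sequence of adjacent vertices. -/
theorem exists_walk_of_seq {G : SimpleGraph V} (f : ℕ → V) (hf : ∀ i, G.Adj (f i) (f (i + 1)))
    {s t : ℕ} (hst : s ≤ t) :
    ∃ w : G.Walk (f s) (f t), w.support = (List.range' s (t + 1 - s)).map f := by
  obtain ⟨k, rfl⟩ := Nat.exists_eq_add_of_le hst
  clear hst
  induction k generalizing s with
  | zero => exact ⟨.nil, by simp⟩
  | succ k ih =>
    obtain ⟨w, hw⟩ := ih (s := s + 1)
    refine ⟨(SimpleGraph.Walk.cons (hf s) w).copy rfl (by congr 1; omega), ?_⟩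
    rw [SimpleGraph.Walk.support_copy, SimpleGraph.Walk.support_cons, hw,
      show s + (k + 1) + 1 - s = (s + 1 + k + 1 - (s + 1)) + 1 by omega, List.range'_succ,
      List.map_cons]

/-- A periodic parametrisation of a cycle starting from a given vertex. -/
theorem exists_cycle_param [DecidableEq V] {G : SimpleGraph V} {a : V} {c : G.Walk a a}
    (hc : c.IsCycle) {v : V} (hv : v ∈ c.support) :
    ∃ f : ℕ → V, f 0 = v ∧ (∀ i, f (i + c.length) = f i) ∧ (∀ i, cSucc c (f i) = f (i + 1)) ∧
      (∀ i, cPred c (f (i + 1)) = f i) ∧ (∀ i, G.Adj (f i) (f (i + 1))) ∧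
      Set.InjOn f {i | i < c.length} ∧ (∀ i, f i ∈ c.support) ∧
      (∀ y ∈ c.support, ∃ i < c.length, f i = y) := by
  have hlen : c.support.tail.length = c.length := by simp
  have hpos : 0 < c.length := by have := hc.three_le_length; omega
  have hmem : ∀ y ∈ c.support, y ∈ c.support.tail := by
    intro y hy
    rw [SimpleGraph.Walk.mem_support_iff] at hy
    rcases hy with rfl | hy
    · exact c.end_mem_tail_support hc.not_nil
    · exact hy
  obtain ⟨k, hk, hkv⟩ := List.getElem_of_mem (hmem v hv)
  set l := c.support.tail with hl
  have hnd : l.Nodup := hc.support_nodup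
  have hlt : ∀ i, i % c.length < l.length := fun i => (Nat.mod_lt _ hpos).trans_eq hlen.symm
  have hsucc : ∀ i, cSucc c (l[(k + i) % c.length]'(hlt _)) =
      l[(k + (i + 1)) % c.length]'(hlt _) := by
    intro i
    rw [cSucc, dif_pos (List.getElem_mem _)]
    refine (List.next_getElem l hnd _ (hlt _)).trans ?_
    congr 1
    rw [hlen, Nat.mod_add_mod, add_assoc]
  refine ⟨fun i => l[(k + i) % c.length]'(hlt _), ?_, ?_, hsucc, ?_, ?_, ?_, ?_, ?_⟩
  · rw [hlen] at hk
    simp only [add_zero, Nat.mod_eq_of_lt hk]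
    exact hkv
  · intro i
    simp only [← add_assoc, Nat.add_mod_right]
  · intro i
    have h := hsucc i
    rw [cSucc, dif_pos (List.getElem_mem _)] at h
    simp only [← h]
    rw [cPred, dif_pos (List.next_mem _ _ _)]
    exact List.prev_next l hnd _ _
  · intro i
    have hget : ∀ j (hj : j < l.length), l[j] = c.getVert (j + 1) := by
      intro j hj
      rw [c.getVert_eq_support_getElem (by omega)]
      simp [hl]
    have h := Nat.mod_lt (k + i) hpos
    simp only [hget]
    rcases Nat.lt_or_ge ((k + i) % c.length + 1) c.length with h' | h'
    · have : (k + (i + 1)) % c.length = (k + i) % c.length + 1 := by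
        rw [← add_assoc, ← Nat.mod_add_mod, Nat.mod_eq_of_lt h']
      rw [this]
      exact c.adj_getVert_succ h'
    · have h₁ : (k + i) % c.length + 1 = c.length := by omega
      have : (k + (i + 1)) % c.length = 0 := by
        rw [← add_assoc, ← Nat.mod_add_mod, h₁, Nat.mod_self]
      rw [this, h₁, c.getVert_length]
      simpa using c.adj_getVert_succ hpos
  · intro i hi j hj hij
    have h : (k + i) % c.length = (k + j) % c.length := (hnd.getElem_inj_iff).1 hij
    have h' : i ≡ j [MOD c.length] := Nat.ModEq.add_left_cancel' k h
    exact h'.eq_of_lt_of_lt hi hj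
  · exact fun i => List.mem_of_mem_tail (List.getElem_mem _)
  · intro y hy
    obtain ⟨j, hj, rfl⟩ := List.getElem_of_mem (hmem y hy)
    rw [hlen] at hj hk
    rcases Nat.lt_or_ge j k with h | h
    · refine ⟨j + c.length - k, by omega, ?_⟩
      simp only [show k + (j + c.length - k) = j + c.length by omega, Nat.add_mod_right,
        Nat.mod_eq_of_lt hj]
    · refine ⟨j - k, by omega, ?_⟩
      simp only [show k + (j - k) = j by omega, Nat.mod_eq_of_lt hj]

theorem stmt15 {V : Type*} [Fintype V] [DecidableEq V] (G : SimpleGraph V)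
    (hn : 3 ≤ Fintype.card V) (htough : OneTough G) (hsig : Fintype.card V ≤ sigma3 G)
    (hham : ¬ G.IsHamiltonian) {a : V} (c : G.Walk a a) (hc : IsLongestCycle G c)
    (u v : V) (hu : u ∉ c.support) (hv : v ∈ c.support)
    (huv1 : G.Adj u (cSucc c v)) (huv2 : G.Adj u (cPred c v))
    (B : Set V) (hB : B = G.neighborSet u ∪ G.neighborSet v)
    (bi bj a' c' : V) (hbi : bi ∈ B) (hbj : bj ∈ B) (horder : bj ∈ arc c bi v)
    (ha' : a' = cSucc c bi) (hc' : c' = cPred c bj) (hac : a' ≠ c') (hadj : G.Adj a' c')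
    (x : V) (hx : ∃ b' ∈ B, b' ∈ arc c bi bj ∧ x = cPred c b') :
    ¬ G.Adj x (cPred c a') ∧ ¬ G.Adj x (cSucc c c') := by
  obtain ⟨hcyc, hmax⟩ := hc
  obtain ⟨f, hf0, hper, hsucc, hpred, hfadj, hinj, hfs, hsurj⟩ := exists_cycle_param hcyc hv
  have h3 := hcyc.three_le_length
  set n := c.length with hn'
  have hiter : ∀ k i, (cSucc c)^[k] (f i) = f (i + k) := by
    intro k
    induction k with
    | zero => simp
    | succ k ih =>
      intro i
      rw [Function.iterate_succ_apply, hsucc, ih]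
      congr 1
      omega
  have hbi_mem : bi ∈ c.support := by
    by_contra h
    obtain ⟨-, q, -, -, -, hq, -⟩ := horder
    have hfix : cSucc c bi = bi := dif_neg fun h' => h (List.mem_of_mem_tail h')
    rw [Function.iterate_fixed hfix] at hq
    exact h (hq ▸ hv)
  obtain ⟨i, hi, rfl⟩ := hsurj bi hbi_mem
  obtain ⟨j, hj, hij, rfl⟩ : ∃ j < n, i < j ∧ bj = f j := by
    obtain ⟨p, q, hp, hpq, hq, hqv, rfl⟩ := horder
    rw [hiter, ← hf0] at hqv
    refine ⟨i + p, ?_, by omega, hiter _ _⟩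
    rcases Nat.lt_trichotomy (i + q) n with h | h | h
    · have : i + q = 0 := hinj h (by simp; omega) hqv
      omega
    · omega
    · rw [show i + q = i + q - n + n by omega, hper] at hqv
      have : i + q - n = 0 := hinj (by simp; omega) (by simp; omega) hqv
      omega
  have hi0 : 1 ≤ i := by
    obtain ⟨p, q, hp, hpq, hq, hqv, -⟩ := horder
    rw [hiter, ← hf0] at hqv
    by_contra h
    have : i + q = 0 := hinj (by simp; omega) (by simp; omega) hqv
    omega
  obtain ⟨b, hb, hbarc, rfl⟩ := hx
  obtain ⟨m, him, hmj, rfl⟩ : ∃ m, i < m ∧ m < j ∧ b = f m := by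
    obtain ⟨p, q, hp, hpq, hq, hqv, rfl⟩ := hbarc
    rw [hiter] at hqv
    refine ⟨i + p, by omega, ?_, hiter _ _⟩
    rcases Nat.lt_or_ge (i + q) n with h | h
    · have : i + q = j := hinj h hj hqv
      omega
    · rw [show i + q = i + q - n + n by omega, hper] at hqv
      have : i + q - n = j := hinj (by simp; omega) hj hqv
      omega
  have hpred' : ∀ k, 1 ≤ k → cPred c (f k) = f (k - 1) := by
    intro k hk
    obtain ⟨k, rfl⟩ := Nat.exists_eq_add_of_le' hk
    exact hpred k
  rw [hsucc] at ha'
  rw [hpred' j (by omega)] at hc'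
  subst ha' hc'
  rw [hpred' m (by omega), hpred, hsucc, Nat.sub_add_cancel (by omega : 1 ≤ j)]
  have hus : G.Adj u (f 1) := by rwa [← hf0, hsucc] at huv1
  have hvs : G.Adj v (f 1) := hf0 ▸ hfadj 0
  have hlast : f (n - 1 + 1) = v := by
    rw [Nat.sub_add_cancel (by omega), ← hf0, ← hper 0, zero_add]
  have hut : G.Adj u (f (n - 1)) := by rwa [← hlast, hpred] at huv2
  have hvt : G.Adj v (f (n - 1)) := hlast ▸ (hfadj (n - 1)).symm
  have hB' : ∀ k, f k ∈ B → G.Adj u (f k) ∨ G.Adj v (f k) := by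
    intro k hk
    rw [hB] at hk
    exact hk
  -- No two paths through the vertices of `c` other than `v` can be closed up through `u` and `v`.
  have key : ∀ e e' (w : G.Walk (f 1) e) (w' : G.Walk e' (f (n - 1))),
      (w.support ++ w'.support).Perm ((List.range' 1 (n - 1)).map f) →
      (G.Adj u e ∨ G.Adj v e) → (G.Adj u e' ∨ G.Adj v e') → False := by
    intro e e' w w' hperm he he'
    have hnd : (u :: v :: (w.support ++ w'.support)).Nodup := by
      rw [((hperm.cons v).cons u).nodup_iff, ← hf0, ← List.map_cons,
        show 0 :: List.range' 1 (n - 1) = List.range n by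
          rw [List.range_eq_range', show n = n - 1 + 1 by omega, List.range'_succ,
            Nat.add_sub_cancel],
        List.nodup_cons]
      refine ⟨?_, List.Nodup.map_on ?_ List.nodup_range⟩
      · rw [List.mem_map]
        rintro ⟨k, -, rfl⟩
        exact hu (hfs k)
      · intro x hx y hy h
        exact hinj (List.mem_range.1 hx) (List.mem_range.1 hy) h
    obtain ⟨b, d, hd, hl⟩ := exists_isCycle_of_two_paths w w' hnd hus hut hvs hvt he he'
    have h₁ := hmax b d hd
    have h₂ := hperm.length_eq
    simp only [List.length_append, List.length_map, List.length_range'] at h₂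
    omega
  have hsplit : (List.range' 1 (n - 1)).map f =
      (List.range' 1 (i + 1 - 1)).map f ++ ((List.range' (i + 1) (m - 1 + 1 - (i + 1))).map f ++
        ((List.range' m (j - 1 + 1 - m)).map f ++ (List.range' j (n - 1 + 1 - j)).map f)) := by
    simp only [← List.map_append]
    congr 1
    rw [show n - 1 = (i + 1 - 1) + ((m - 1 + 1 - (i + 1)) + ((j - 1 + 1 - m) + (n - 1 + 1 - j)))
      by omega]
    simp only [← List.range'_append_1]
    congr! 3 <;> grind
  obtain ⟨wA, hA⟩ := exists_walk_of_seq f hfadj hi0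
  obtain ⟨wM, hM⟩ := exists_walk_of_seq f hfadj (show m ≤ j - 1 by omega)
  obtain ⟨wD, hD⟩ := exists_walk_of_seq f hfadj (show j ≤ n - 1 by omega)
  rcases Nat.lt_or_ge (i + 1) m with him' | him'
  · obtain ⟨wL, hL⟩ := exists_walk_of_seq f hfadj (show i + 1 ≤ m - 1 by omega)
    refine ⟨fun h => ?_, fun h => ?_⟩
    · refine key _ _ (wA.append (.cons h.symm (wL.reverse.append (.cons hadj wM.reverse)))) wD ?_
        (hB' _ hb) (hB' _ hbj)
      simp only [SimpleGraph.Walk.support_append, SimpleGraph.Walk.support_cons, List.tail_cons,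
        SimpleGraph.Walk.support_reverse, hsplit, hA, hM, hD, hL, List.append_assoc]
      exact (((List.reverse_perm _).append ((List.reverse_perm _).append_right _))).append_left _
    · refine key _ _ wA (wM.append (.cons hadj.symm (wL.append (.cons h wD)))) ?_
        (hB' _ hbi) (hB' _ hb)
      simp only [SimpleGraph.Walk.support_append, SimpleGraph.Walk.support_cons, List.tail_cons,
        hsplit, hA, hM, hD, hL]
      refine List.Perm.append_left _ ?_
      rw [← List.append_assoc, ← List.append_assoc]
      exact List.perm_append_comm.append_right _
  · obtain rfl : m = i + 1 := by omega
    have hcons : False := by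
      refine key _ _ wA (wM.append (.cons ?_ wD)) ?_ (hB' _ hbi) (hB' _ hb)
      · have := hfadj (j - 1)
        rwa [Nat.sub_add_cancel (by omega)] at this
      · simp [SimpleGraph.Walk.support_append, hsplit, hA, hM, hD]
    exact hcons.elim

end
end Paper
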